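/- For n ≥ 2, the Gallai-Ramsey multiplicity GM_3(P_5 : nK_2) satisfies n! ≤ GM_3(P_5 : nK_2) ≤ (2n)!/(2^n · n!). -/

import Mathlib

open SimpleGraph Function

namespace GR

/-- The set of copies of a graph `H` (assumed without isolated vertices, so a copy is
identified with its edge set) inside the complete graph on `Fin n`. -/
def copies {α : Type} (H : SimpleGraph α) (n : ℕ) : Set (Set (Sym2 (Fin n))) :=
  {S | ∃ f : α → Fin n, Function.Injective f ∧ S = (Sym2.map f) '' H.edgeSet}

/-- `S` is a monochromatic copy of `H` under the edge-coloring `c`. -/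
def IsMonoCopy {α C : Type} (H : SimpleGraph α) {n : ℕ}
    (c : Sym2 (Fin n) → C) (S : Set (Sym2 (Fin n))) : Prop :=
  S ∈ copies H n ∧ ∃ col, ∀ e ∈ S, c e = col

/-- `S` is a rainbow copy of `G` under the edge-coloring `c`. -/
def IsRainbowCopy {α C : Type} (G : SimpleGraph α) {n : ℕ}
    (c : Sym2 (Fin n) → C) (S : Set (Sym2 (Fin n))) : Prop :=
  S ∈ copies G n ∧ Set.InjOn c S

def HasMonoCopy {α C : Type} (H : SimpleGraph α) {n : ℕ} (c : Sym2 (Fin n) → C) : Prop :=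
  ∃ S, IsMonoCopy H c S

def HasRainbowCopy {α C : Type} (G : SimpleGraph α) {n : ℕ} (c : Sym2 (Fin n) → C) : Prop :=
  ∃ S, IsRainbowCopy G c S

/-- The `k`-colored Gallai-Ramsey number `gr_k(G : H)`. -/
noncomputable def gr {α β : Type} (k : ℕ) (G : SimpleGraph α) (H : SimpleGraph β) : ℕ :=
  sInf {n | ∀ c : Sym2 (Fin n) → Fin k, HasRainbowCopy G c ∨ HasMonoCopy H c}

/-- The diagonal `k`-colored Ramsey number `r_k(H)`. -/
noncomputable def ramsey {β : Type} (k : ℕ) (H : SimpleGraph β) : ℕ :=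
  sInf {n | ∀ c : Sym2 (Fin n) → Fin k, HasMonoCopy H c}

/-- The matching with `n` edges, `nK₂`. -/
def nK2 (n : ℕ) : SimpleGraph (Fin n × Fin 2) :=
  SimpleGraph.fromRel (fun a b => a.1 = b.1)

/-- The path on 5 vertices. -/
def P5 : SimpleGraph (Fin 5) := SimpleGraph.pathGraph 5

/-- The star with three leaves. -/
def K13 : SimpleGraph (Fin 1 ⊕ Fin 3) := completeBipartiteGraph (Fin 1) (Fin 3)

/-- The triangle. -/
def K3 : SimpleGraph (Fin 3) := completeGraph (Fin 3)

/-- Number of monochromatic copies of `H` under the coloring `c`. -/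
noncomputable def monoCopyCount {α C : Type} (H : SimpleGraph α) {n : ℕ}
    (c : Sym2 (Fin n) → C) : ℕ :=
  Set.ncard {S | IsMonoCopy H c S}

/-- Number of rainbow copies of `G` under the coloring `c`. -/
noncomputable def rainbowCopyCount {α C : Type} (G : SimpleGraph α) {n : ℕ}
    (c : Sym2 (Fin n) → C) : ℕ :=
  Set.ncard {S | IsRainbowCopy G c S}

/-- The Gallai-Ramsey multiplicity: the minimum, over exact `k`-colorings of the complete
graph on `gr_k(G:H)` vertices, of the number of rainbow copies of `G` plus the number of
monochromatic copies of `H`. -/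
noncomputable def GM {α β : Type} (k : ℕ) (G : SimpleGraph α) (H : SimpleGraph β) : ℕ :=
  sInf {t | ∃ c : Sym2 (Fin (gr k G H)) → Fin k, Surjective c ∧
    t = rainbowCopyCount G c + monoCopyCount H c}

end GR

namespace GR

section Counting

variable {V C : Type}

/-- `M` is a matching inside `U` all of whose edges have color `i`. -/
def IsColorMatching (c : Sym2 V → C) (U : Finset V) (i : C) (M : Finset (Sym2 V)) : Prop :=
  ∀ e ∈ M, ¬ e.IsDiag ∧ c e = i ∧ (∀ v ∈ e, v ∈ U) ∧ ∀ f ∈ M, ∀ v ∈ e, v ∈ f → e = f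

open Classical in
/-- The color-`i` matchings with `n` edges inside `U`. -/
noncomputable def matchings [Fintype V] (c : Sym2 V → C) (U : Finset V) (i : C) (n : ℕ) :
    Finset (Finset (Sym2 V)) :=
  {M | IsColorMatching c U i M ∧ M.card = n}

theorem mem_matchings [Fintype V] {c : Sym2 V → C} {U : Finset V} {i : C} {n : ℕ}
    {M : Finset (Sym2 V)} : M ∈ matchings c U i n ↔ IsColorMatching c U i M ∧ M.card = n := by
  simp [matchings]

theorem IsColorMatching.notMem_edge {c : Sym2 V → C} {U' : Finset V} {i : C}
    {M : Finset (Sym2 V)} (hM : IsColorMatching c U' i M) {a b : V} (ha' : a ∉ U') :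
    s(a, b) ∉ M :=
  fun h => ha' ((hM _ h).2.2.1 a (Sym2.mem_mk_left a b))

theorem card_matchings_zero [Fintype V] (c : Sym2 V → C) (U : Finset V) (i : C) :
    (matchings c U i 0).card = 1 := by
  rw [Finset.card_eq_one]
  refine ⟨∅, ?_⟩
  ext M
  rw [mem_matchings, Finset.card_eq_zero, Finset.mem_singleton]
  constructor
  · exact fun h => h.2
  · rintro rfl
    exact ⟨fun e he => by simp at he, rfl⟩

theorem IsColorMatching.card_le_of_cover {c : Sym2 V → C} {U W : Finset V} {i : C}
    {M : Finset (Sym2 V)} (hM : IsColorMatching c U i M) (hW : ∀ e ∈ M, ∃ v ∈ e, v ∈ W) :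
    M.card ≤ W.card := by
  choose g hge hgW using fun e : M => hW e e.2
  have hinj : Injective fun e => (⟨g e, hgW e⟩ : W) := by
    intro e f h
    have h : g e = g f := congrArg Subtype.val h
    exact Subtype.ext ((hM e e.2).2.2.2 f f.2 (g e) (hge e) (h ▸ hge f))
  simpa using Fintype.card_le_of_injective _ hinj

variable [DecidableEq V]

/-- The neighbours of `v` in `U` along edges of color `i`. -/
def nbrs [DecidableEq C] (c : Sym2 V → C) (U : Finset V) (i : C) (v : V) : Finset V :=
  {x ∈ U | x ≠ v ∧ c s(v, x) = i}

theorem mem_nbrs [DecidableEq C] {c : Sym2 V → C} {U : Finset V} {i : C} {v x : V} :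
    x ∈ nbrs c U i v ↔ x ∈ U ∧ x ≠ v ∧ c s(v, x) = i := by
  simp [nbrs]

theorem disjoint_nbrs [DecidableEq C] (c : Sym2 V → C) (U : Finset V) {i j : C} (hij : i ≠ j)
    (v : V) : Disjoint (nbrs c U i v) (nbrs c U j v) := by
  rw [Finset.disjoint_left]
  intro x hx hx'
  rw [mem_nbrs] at hx hx'
  exact hij (hx.2.2.symm.trans hx'.2.2)

theorem IsColorMatching.insert_edge {c : Sym2 V → C} {U U' : Finset V} {i : C}
    {M : Finset (Sym2 V)} (hM : IsColorMatching c U' i M) (hU : U' ⊆ U) {a b : V}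
    (ha : a ∈ U) (hb : b ∈ U) (ha' : a ∉ U') (hb' : b ∉ U') (hab : a ≠ b)
    (hc : c s(a, b) = i) : IsColorMatching c U i (insert s(a, b) M) := by
  have key : ∀ f ∈ M, ∀ v ∈ s(a, b), v ∉ f := by
    intro f hf v hv hvf
    have := (hM f hf).2.2.1 v hvf
    rcases Sym2.mem_iff.1 hv with rfl | rfl
    · exact ha' this
    · exact hb' this
  intro e he
  rcases Finset.mem_insert.1 he with rfl | he
  · refine ⟨by simpa using hab, hc, ?_, ?_⟩
    · intro v hv
      rcases Sym2.mem_iff.1 hv with rfl | rfl <;> assumption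
    · intro f hf v hv hvf
      rcases Finset.mem_insert.1 hf with rfl | hf
      · rfl
      · exact absurd hvf (key f hf v hv)
  · obtain ⟨h1, h2, h3, h4⟩ := hM e he
    refine ⟨h1, h2, fun v hv => hU (h3 v hv), ?_⟩
    intro f hf v hv hvf
    rcases Finset.mem_insert.1 hf with rfl | hf
    · exact absurd hv (key e he v hvf)
    · exact h4 f hf v hv hvf

theorem card_matchings_le_filter [Fintype V] (c : Sym2 V → C) {U U' : Finset V} {i : C} (n : ℕ)
    (hU : U' ⊆ U) {a b : V} (ha : a ∈ U) (hb : b ∈ U) (ha' : a ∉ U') (hb' : b ∉ U')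
    (hab : a ≠ b) (hc : c s(a, b) = i) :
    (matchings c U' i n).card ≤ {M ∈ matchings c U i (n + 1) | s(a, b) ∈ M}.card := by
  apply Finset.card_le_card_of_injOn (fun M => insert s(a, b) M)
  · intro M hM
    have hM := mem_matchings.1 hM
    simp only [Finset.coe_filter, Set.mem_ofPred_eq, Finset.mem_insert_self, and_true]
    exact mem_matchings.2 ⟨hM.1.insert_edge hU ha hb ha' hb' hab hc, by
      rw [Finset.card_insert_of_notMem (hM.1.notMem_edge ha'), hM.2]⟩
  · intro M hM N hN h
    have hM := (mem_matchings.1 hM).1.notMem_edge (b := b) ha'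
    have hN := (mem_matchings.1 hN).1.notMem_edge (b := b) ha'
    have := congrArg (fun S => S.erase s(a, b)) h
    simpa [hM, hN] using this

/-- Double counting of pairs (edge `s(a t, b t)`, matching extending it): each matching is
obtained at most once for every value of `g`. -/
theorem sum_card_matchings_le [Fintype V] {T β : Type} [Fintype T] [Fintype β]
    (c : Sym2 V → C) (U : Finset V) (i : C) (n : ℕ) (U' : T → Finset V) (a b : T → V) (g : T → β)
    (hU : ∀ t, U' t ⊆ U) (ha : ∀ t, a t ∈ U) (hb : ∀ t, b t ∈ U) (ha' : ∀ t, a t ∉ U' t)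
    (hb' : ∀ t, b t ∉ U' t) (hab : ∀ t, a t ≠ b t) (hc : ∀ t, c s(a t, b t) = i)
    (hg : ∀ t t', g t = g t' → a t = a t' ∧ (b t = b t' → t = t')) :
    ∑ t, (matchings c (U' t) i n).card ≤
      Fintype.card β * (matchings c U i (n + 1)).card := by
  calc ∑ t, (matchings c (U' t) i n).card
      ≤ ∑ t, {M ∈ matchings c U i (n + 1) | s(a t, b t) ∈ M}.card :=
        Finset.sum_le_sum fun t _ => card_matchings_le_filter c n (hU t) (ha t) (hb t) (ha' t)
          (hb' t) (hab t) (hc t)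
    _ = ∑ M ∈ matchings c U i (n + 1), ({t | s(a t, b t) ∈ M} : Finset T).card :=
        Finset.sum_card_bipartiteAbove_eq_sum_card_bipartiteBelow (fun t M => s(a t, b t) ∈ M)
    _ ≤ ∑ M ∈ matchings c U i (n + 1), Fintype.card β := by
        apply Finset.sum_le_sum
        intro M hM
        have hM := (mem_matchings.1 hM).1
        refine (Finset.card_le_card_of_injOn g (t := Finset.univ) (by simp) ?_)
        intro t ht t' ht' h
        simp only [Finset.coe_filter, Finset.mem_univ, true_and, Set.mem_ofPred_eq] at ht ht'
        obtain ⟨h1, h2⟩ := hg t t' h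
        apply h2
        have := (hM _ ht).2.2.2 _ ht' (a t) (Sym2.mem_mk_left _ _)
          (by rw [h1]; exact Sym2.mem_mk_left _ _)
        rw [h1] at this
        exact Sym2.congr_right.1 this
    _ = _ := by rw [Finset.sum_const, smul_eq_mul, mul_comm]

theorem exists_injective_of_le_card {α : Type} {S : Finset α} {N : ℕ} (h : N ≤ S.card) :
    ∃ x : Fin N → α, Injective x ∧ ∀ t, x t ∈ S := by
  obtain ⟨f⟩ := Function.Embedding.nonempty_of_card_le (α := Fin N) (β := S) (by simpa using h)
  exact ⟨fun t => f t, fun t t' h => f.injective (Subtype.ext h), fun t => (f t).2⟩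

theorem exists_injective_pair {A B X : Finset V} {N : ℕ} (hA : N ≤ A.card) (hB : N ≤ B.card)
    (hX : N ≤ (A ∩ X).card + (B ∩ X).card) :
    ∃ x y : Fin N → V, Injective x ∧ Injective y ∧ (∀ t, x t ∈ A) ∧ (∀ t, y t ∈ B) ∧
      ∀ t, x t ∈ X ∨ y t ∈ X := by
  obtain ⟨A₀, hA₀, hcA₀⟩ := Finset.exists_subset_card_eq (min_le_right N (A ∩ X).card)
  obtain ⟨B₀, hB₀, hcB₀⟩ := Finset.exists_subset_card_eq
    (show N - min N (A ∩ X).card ≤ (B ∩ X).card by omega)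
  obtain ⟨A₁, hA₁, hA₁A, hcA₁⟩ := Finset.exists_subsuperset_card_eq
    (hA₀.trans Finset.inter_subset_left) (show A₀.card ≤ N by omega) hA
  obtain ⟨B₁, hB₁, hB₁B, hcB₁⟩ := Finset.exists_subsuperset_card_eq
    (hB₀.trans Finset.inter_subset_left) (show B₀.card ≤ N by omega) hB
  obtain ⟨x⟩ : Nonempty (Fin N ≃ A₁) := by
    rw [← Fintype.card_eq, Fintype.card_coe, hcA₁, Fintype.card_fin]
  obtain ⟨σ⟩ : Nonempty ({t : Fin N // (x t : V) ∉ A₀} ≃ B₀) := by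
    rw [← Fintype.card_eq, Fintype.card_coe, hcB₀, Fintype.card_subtype_compl, Fintype.card_fin,
      ← hcA₀]
    congr 1
    rw [← Fintype.card_coe]
    refine Fintype.card_congr ((x.subtypeEquiv
      (p := fun t => (x t : V) ∈ A₀) (q := fun z : A₁ => (z : V) ∈ A₀) (fun _ => Iff.rfl)).trans
      (Equiv.subtypeSubtypeEquivSubtype (fun h => hA₁ h)))
  obtain ⟨y, hy⟩ := Finset.exists_equiv_extend_of_card_eq (α := Fin N) (t := B₁)
    (by simp [hcB₁]) (s := {t | (x t : V) ∉ A₀})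
    (f := fun t => if h : (x t : V) ∉ A₀ then (σ ⟨t, h⟩ : V) else x t)
    (by
      intro z hz
      simp only [Finset.mem_image, Finset.mem_filter, Finset.mem_univ, true_and] at hz
      obtain ⟨t, ht, rfl⟩ := hz
      rw [dif_pos ht]
      exact hB₁ (σ _).2)
    (by
      intro t ht t' ht' h
      simp only [Finset.coe_filter, Finset.mem_univ, true_and, Set.mem_ofPred_eq] at ht ht'
      simp only [dif_pos ht, dif_pos ht'] at h
      simpa using σ.injective (Subtype.ext h))
  refine ⟨fun t => x t, fun t => y t, fun t t' h => x.injective (Subtype.ext h),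
    fun t t' h => y.injective (Subtype.ext h), fun t => hA₁A (x t).2, fun t => hB₁B (y t).2, ?_⟩
  intro t
  by_cases h : (x t : V) ∈ A₀
  · exact Or.inl (Finset.mem_inter.1 (hA₀ h)).2
  · right
    have := hy t (by simpa using h)
    rw [dif_pos h] at this
    change (y t : V) ∈ X
    rw [this]
    exact (Finset.mem_inter.1 (hB₀ (σ _).2)).2

theorem IsColorMatching.card_biUnion_toFinset {c : Sym2 V → C} {U : Finset V} {i : C}
    {M : Finset (Sym2 V)} (hM : IsColorMatching c U i M) :
    (M.biUnion Sym2.toFinset).card = 2 * M.card := by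
  rw [Finset.card_biUnion, Finset.sum_congr rfl
    (fun e he => Sym2.card_toFinset_of_not_isDiag e (hM e he).1), Finset.sum_const, smul_eq_mul,
    mul_comm]
  intro e he f hf hne
  refine Finset.disjoint_left.2 fun w hw hw' => hne ?_
  exact (hM e he).2.2.2 f hf w (Sym2.mem_toFinset.1 hw) (Sym2.mem_toFinset.1 hw')

theorem IsColorMatching.biUnion_toFinset_subset {c : Sym2 V → C} {U : Finset V} {i : C}
    {M : Finset (Sym2 V)} (hM : IsColorMatching c U i M) : M.biUnion Sym2.toFinset ⊆ U := by
  intro w hw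
  obtain ⟨e, he, hwe⟩ := Finset.mem_biUnion.1 hw
  exact (hM e he).2.2.1 w (Sym2.mem_toFinset.1 hwe)

open Nat in
/-- A set of `2n` vertices contains at most `(2n - 1)‼` matchings with `n` edges. -/
theorem card_matchings_le_doubleFactorial [Fintype V] (c : Sym2 V → C) (i : C) (n : ℕ) :
    ∀ U : Finset V, U.card = 2 * n → (matchings c U i n).card ≤ (2 * n - 1)‼ := by
  induction n with
  | zero => intro U _; simp [card_matchings_zero]
  | succ n ih =>
    intro U hU
    obtain ⟨v, hv⟩ : U.Nonempty := Finset.card_pos.1 (by omega)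
    have hsub : matchings c U i (n + 1) ⊆ (U.erase v).biUnion fun x =>
        (matchings c (U \ {v, x}) i n).image (insert s(v, x)) := by
      intro M hM
      obtain ⟨hM, hcard⟩ := mem_matchings.1 hM
      have hcov : M.biUnion Sym2.toFinset = U :=
        Finset.eq_of_subset_of_card_le hM.biUnion_toFinset_subset
          (by rw [hM.card_biUnion_toFinset, hcard, hU])
      obtain ⟨e, he, hve⟩ := Finset.mem_biUnion.1 (hcov.symm ▸ hv)
      obtain ⟨x, rfl⟩ := Sym2.mem_toFinset.1 hve
      have hx := hM _ he
      refine Finset.mem_biUnion.2 ⟨x, Finset.mem_erase.2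
        ⟨fun h => hx.1 (by simp [h]), hx.2.2.1 x (Sym2.mem_mk_right _ _)⟩, ?_⟩
      refine Finset.mem_image.2 ⟨M.erase s(v, x), mem_matchings.2 ⟨?_, ?_⟩,
        Finset.insert_erase he⟩
      · intro f hf
        obtain ⟨hne, hf⟩ := Finset.mem_erase.1 hf
        obtain ⟨h1, h2, h3, h4⟩ := hM f hf
        refine ⟨h1, h2, fun w hw => ?_, fun g hg => h4 g (Finset.mem_of_mem_erase hg)⟩
        simp only [Finset.mem_sdiff, h3 w hw, true_and, Finset.mem_insert, Finset.mem_singleton]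
        intro hw'
        exact hne (h4 _ he w hw (Sym2.mem_iff.2 hw'))
      · rw [Finset.card_erase_of_mem he, hcard]; rfl
    refine (Finset.card_le_card hsub).trans (Finset.card_biUnion_le.trans ?_)
    calc _ ≤ ∑ x ∈ U.erase v, (2 * n - 1)‼ := by
          apply Finset.sum_le_sum
          intro x hx
          obtain ⟨hxv, hxU⟩ := Finset.mem_erase.1 hx
          refine Finset.card_image_le.trans (ih _ ?_)
          rw [Finset.card_sdiff_of_subset (Finset.insert_subset hv (by simpa using hxU)), hU,
            Finset.card_pair hxv.symm]
          omega
      _ = (2 * (n + 1) - 1)‼ := by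
          rw [Finset.sum_const, Finset.card_erase_of_mem hv, hU, smul_eq_mul,
            show 2 * (n + 1) - 1 = 2 * n + 1 by omega, Nat.doubleFactorial_add_one]

variable [DecidableEq C]

theorem card_nbrs_add_card_nbrs_le (c : Sym2 V → C) {i j : C} (hij : i ≠ j) (U R : Finset V)
    (w : V) : (nbrs c U i w).card + (nbrs c U j w).card ≤
      (nbrs c (U \ R) i w).card + (nbrs c (U \ R) j w).card + R.card := by
  rw [← Finset.card_union_of_disjoint (disjoint_nbrs c U hij w),
    ← Finset.card_union_of_disjoint (disjoint_nbrs c (U \ R) hij w)]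
  refine le_trans (Finset.card_le_card ?_) (Finset.card_union_le _ _)
  intro z hz
  simp only [Finset.mem_union, mem_nbrs, Finset.mem_sdiff] at hz ⊢
  tauto

theorem card_nbrs_three (c : Sym2 V → C) {i j k : C} (hij : i ≠ j) (hik : i ≠ k) (hjk : j ≠ k)
    (htot : ∀ e, c e = i ∨ c e = j ∨ c e = k) {U : Finset V} {v : V} (hv : v ∈ U) :
    (nbrs c U i v).card + (nbrs c U j v).card + (nbrs c U k v).card + 1 = U.card := by
  rw [← Finset.card_union_of_disjoint (disjoint_nbrs c U hij v),
    ← Finset.card_union_of_disjoint (Finset.disjoint_union_left.2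
      ⟨disjoint_nbrs c U hik v, disjoint_nbrs c U hjk v⟩),
    ← Finset.card_erase_add_one hv]
  congr 2
  ext z
  have := htot s(v, z)
  simp only [Finset.mem_union, mem_nbrs, Finset.mem_erase]
  tauto

variable [Fintype V]

open Nat in
/-- If `n` vertices each have at least `n` neighbours of color `i` outside the set they form,
then there are at least `n!` matchings of color `i` with `n` edges. -/
theorem factorial_le_card_matchings_of_nbrs_sdiff (c : Sym2 V → C) (i : C) (n : ℕ) :
    ∀ U P : Finset V, P ⊆ U → P.card = n → (∀ v ∈ P, n ≤ (nbrs c U i v \ P).card) →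
      n ! ≤ (matchings c U i n).card := by
  induction n with
  | zero => intro U P _ _ _; simp [card_matchings_zero]
  | succ n ih =>
    intro U P hPU hP hd
    obtain ⟨v, hv⟩ : P.Nonempty := Finset.card_pos.1 (by omega)
    obtain ⟨x, hx, hxm⟩ := exists_injective_of_le_card (hd v hv)
    simp only [Finset.mem_sdiff, mem_nbrs] at hxm
    have key := sum_card_matchings_le (T := Fin (n + 1)) (β := Unit) c U i n
      (fun t => U \ {v, x t}) (fun _ => v) x (fun _ => ())
      (fun t => Finset.sdiff_subset) (fun t => hPU hv) (fun t => (hxm t).1.1) (by simp) (by simp)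
      (fun t => (hxm t).1.2.1.symm) (fun t => (hxm t).1.2.2)
      (fun t t' _ => ⟨rfl, fun h => hx h⟩)
    have hlow : ∀ t : Fin (n + 1), n ! ≤ (matchings c (U \ {v, x t}) i n).card := by
      intro t
      apply ih _ (P.erase v)
      · intro w hw
        rw [Finset.mem_erase] at hw
        have : w ≠ x t := by rintro rfl; exact (hxm t).2 hw.2
        simp [hPU hw.2, hw.1, this]
      · rw [Finset.card_erase_of_mem hv, hP]; rfl
      · intro w hw
        rw [Finset.mem_erase] at hw
        have hsub : (nbrs c U i w \ P).erase (x t) ⊆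
            nbrs c (U \ {v, x t}) i w \ P.erase v := by
          intro z hz
          simp only [Finset.mem_erase, Finset.mem_sdiff, mem_nbrs] at hz
          have hzv : z ≠ v := by rintro rfl; exact hz.2.2 hv
          simp only [Finset.mem_sdiff, mem_nbrs, Finset.mem_erase, Finset.mem_insert,
            Finset.mem_singleton]
          tauto
        have h1 := Finset.card_le_card hsub
        have h2 := Finset.pred_card_le_card_erase (s := nbrs c U i w \ P) (a := x t)
        have h3 := hd w hw.2
        omega
    have hsum := Finset.sum_le_sum (fun t (_ : t ∈ (Finset.univ : Finset (Fin (n + 1)))) => hlow t)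
    simp only [Finset.sum_const, Finset.card_univ, Fintype.card_fin, smul_eq_mul] at hsum
    rw [Nat.factorial_succ]
    simpa using hsum.trans key

open Nat in
/-- If `n` vertices have degree at least `2n - 1` in color `i`, then there are at least `n!`
matchings of color `i` with `n` edges. -/
theorem factorial_le_card_matchings_of_degree (c : Sym2 V → C) (i : C) (n : ℕ)
    {U P : Finset V} (hPU : P ⊆ U) (hP : n ≤ P.card)
    (hd : ∀ v ∈ P, 2 * n ≤ (nbrs c U i v).card + 1) : n ! ≤ (matchings c U i n).card := by
  obtain ⟨P', hP', hcard⟩ := Finset.exists_subset_card_eq hP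
  apply factorial_le_card_matchings_of_nbrs_sdiff c i n U P' (hP'.trans hPU) hcard
  intro v hv
  have hsub : nbrs c U i v \ P'.erase v ⊆ nbrs c U i v \ P' := by
    intro z hz
    simp only [Finset.mem_sdiff, mem_nbrs, Finset.mem_erase] at hz ⊢
    tauto
  have h1 := Finset.card_le_card hsub
  have h2 := Finset.le_card_sdiff (P'.erase v) (nbrs c U i v)
  have h3 := Finset.card_erase_of_mem hv
  have h4 := hd v (hP' hv)
  have h5 := Finset.card_pos.2 ⟨v, hv⟩
  omega

open Nat in
/-- If `2n - 1` vertices have total degree at least `3n - 2` in the two colors `i` and `j`, then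
there are at least `n!` monochromatic matchings with `n` edges in these colors. -/
theorem factorial_le_card_matchings_two (c : Sym2 V → C) {i j : C} (hij : i ≠ j) (n : ℕ) :
    ∀ U P : Finset V, P ⊆ U → 2 * n ≤ P.card + 1 →
      (∀ v ∈ P, 3 * n ≤ (nbrs c U i v).card + (nbrs c U j v).card + 2) →
      n ! ≤ (matchings c U i n).card + (matchings c U j n).card := by
  induction n with
  | zero => intro U P _ _ _; simp [card_matchings_zero]
  | succ n ih =>
    intro U P₀ hPU₀ hP₀ hd₀
    obtain ⟨P, hPP₀, hP⟩ := Finset.exists_subset_card_eq (show 2 * n + 1 ≤ P₀.card by omega)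
    have hPU := hPP₀.trans hPU₀
    have hd : ∀ v ∈ P, 3 * (n + 1) ≤ (nbrs c U i v).card + (nbrs c U j v).card + 2 :=
      fun v hv => hd₀ v (hPP₀ hv)
    by_cases hex : ∃ v ∈ P, n + 1 ≤ (nbrs c U i v).card ∧ n + 1 ≤ (nbrs c U j v).card
    · obtain ⟨v, hv, hvi, hvj⟩ := hex
      have hout : ∀ k, (nbrs c U k v).card =
          (nbrs c U k v ∩ (U \ P)).card + (nbrs c U k v ∩ P.erase v).card := by
        intro k
        rw [← Finset.card_union_of_disjoint]
        · congr 1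
          ext z
          simp only [mem_nbrs, Finset.mem_union, Finset.mem_inter, Finset.mem_sdiff,
            Finset.mem_erase]
          tauto
        · rw [Finset.disjoint_left]
          intro z hz hz'
          simp only [Finset.mem_inter, Finset.mem_sdiff, Finset.mem_erase] at hz hz'
          tauto
      have hin : (nbrs c U i v ∩ P.erase v).card + (nbrs c U j v ∩ P.erase v).card ≤ 2 * n := by
        rw [← Finset.card_union_of_disjoint ((disjoint_nbrs c U hij v).mono
          Finset.inter_subset_left Finset.inter_subset_left)]
        calc _ ≤ (P.erase v).card := Finset.card_le_card
              (Finset.union_subset Finset.inter_subset_right Finset.inter_subset_right)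
          _ = 2 * n := by rw [Finset.card_erase_of_mem hv, hP]; rfl
      obtain ⟨x, y, hx, hy, hxm, hym, hxy⟩ := exists_injective_pair (X := U \ P) hvi hvj (by
        have := hout i; have := hout j; have := hd v hv; omega)
      simp only [mem_nbrs] at hxm hym
      have keyi := sum_card_matchings_le (T := Fin (n + 1)) (β := Unit) c U i n
        (fun t => U \ {v, x t, y t}) (fun _ => v) x (fun _ => ())
        (fun t => Finset.sdiff_subset) (fun t => hPU hv) (fun t => (hxm t).1) (by simp) (by simp)
        (fun t => (hxm t).2.1.symm) (fun t => (hxm t).2.2) (fun t t' _ => ⟨rfl, fun h => hx h⟩)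
      have keyj := sum_card_matchings_le (T := Fin (n + 1)) (β := Unit) c U j n
        (fun t => U \ {v, x t, y t}) (fun _ => v) y (fun _ => ())
        (fun t => Finset.sdiff_subset) (fun t => hPU hv) (fun t => (hym t).1) (by simp) (by simp)
        (fun t => (hym t).2.1.symm) (fun t => (hym t).2.2) (fun t t' _ => ⟨rfl, fun h => hy h⟩)
      have hlow : ∀ t : Fin (n + 1), n ! ≤ (matchings c (U \ {v, x t, y t}) i n).card +
          (matchings c (U \ {v, x t, y t}) j n).card := by
        intro t
        apply ih _ (P \ {v, x t, y t}) (Finset.sdiff_subset_sdiff hPU le_rfl)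
        · obtain ⟨z, hz⟩ : ∃ z, P \ {v, z} ⊆ P \ {v, x t, y t} := by
            rcases hxy t with h | h
            · refine ⟨y t, fun w hw => ?_⟩
              have : w ∈ P → w ≠ x t := by
                rintro hw rfl; exact (Finset.mem_sdiff.1 h).2 hw
              simp only [Finset.mem_sdiff, Finset.mem_insert, Finset.mem_singleton] at hw ⊢
              tauto
            · refine ⟨x t, fun w hw => ?_⟩
              have : w ∈ P → w ≠ y t := by
                rintro hw rfl; exact (Finset.mem_sdiff.1 h).2 hw
              simp only [Finset.mem_sdiff, Finset.mem_insert, Finset.mem_singleton] at hw ⊢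
              tauto
          have h1 := Finset.card_le_card hz
          have h2 := Finset.le_card_sdiff {v, z} P
          have h3 := Finset.card_le_two (a := v) (b := z)
          omega
        · intro w hw
          have h1 := card_nbrs_add_card_nbrs_le c hij U {v, x t, y t} w
          have h2 := hd w (Finset.mem_sdiff.1 hw).1
          have h3 := Finset.card_le_three (a := v) (b := x t) (c := y t)
          omega
      have hsum := Finset.sum_le_sum
        (fun t (_ : t ∈ (Finset.univ : Finset (Fin (n + 1)))) => hlow t)
      rw [Finset.sum_add_distrib] at hsum
      simp only [Finset.sum_const, Finset.card_univ, Fintype.card_fin, smul_eq_mul] at hsum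
      simp only [Fintype.card_unit, one_mul] at keyi keyj
      rw [Nat.factorial_succ]
      omega
    · push Not at hex
      have hcover : P ⊆ {v ∈ P | 2 * (n + 1) ≤ (nbrs c U i v).card + 1} ∪
          {v ∈ P | 2 * (n + 1) ≤ (nbrs c U j v).card + 1} := by
        intro v hv
        have h1 := hex v hv
        have h2 := hd v hv
        simp only [Finset.mem_union, Finset.mem_filter, hv, true_and]
        omega
      have hcard := (Finset.card_le_card hcover).trans (Finset.card_union_le _ _)
      rcases (by omega : n + 1 ≤ {v ∈ P | 2 * (n + 1) ≤ (nbrs c U i v).card + 1}.card ∨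
        n + 1 ≤ {v ∈ P | 2 * (n + 1) ≤ (nbrs c U j v).card + 1}.card) with h | h
      · exact (factorial_le_card_matchings_of_degree c i (n + 1)
          ((Finset.filter_subset _ _).trans hPU) h (fun v hv => (Finset.mem_filter.1 hv).2)).trans
          (Nat.le_add_right _ _)
      · exact (factorial_le_card_matchings_of_degree c j (n + 1)
          ((Finset.filter_subset _ _).trans hPU) h (fun v hv => (Finset.mem_filter.1 hv).2)).trans
          (Nat.le_add_left _ _)


open Nat in
theorem factorial_succ_le_card_matchings_three_of_star (c : Sym2 V → C) {i j k : C} (n : ℕ)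
    (ih : ∀ U : Finset V, 4 * n ≤ U.card + 2 →
      n ! ≤ (matchings c U i n).card + (matchings c U j n).card + (matchings c U k n).card)
    {U : Finset V} (hU : 4 * (n + 1) ≤ U.card + 2) {v : V} (hv : v ∈ U)
    (hvi : n + 1 ≤ (nbrs c U i v).card) (hvj : n + 1 ≤ (nbrs c U j v).card)
    (hvk : n + 1 ≤ (nbrs c U k v).card) :
    (n + 1)! ≤ (matchings c U i (n + 1)).card + (matchings c U j (n + 1)).card +
      (matchings c U k (n + 1)).card := by
  obtain ⟨x, hx, hxm⟩ := exists_injective_of_le_card hvi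
  obtain ⟨y, hy, hym⟩ := exists_injective_of_le_card hvj
  obtain ⟨z, hz, hzm⟩ := exists_injective_of_le_card hvk
  simp only [mem_nbrs] at hxm hym hzm
  have keyi := sum_card_matchings_le (T := Fin (n + 1)) (β := Unit) c U i n
    (fun t => U \ {v, x t, y t, z t}) (fun _ => v) x (fun _ => ())
    (fun t => Finset.sdiff_subset) (fun t => hv) (fun t => (hxm t).1) (by simp) (by simp)
    (fun t => (hxm t).2.1.symm) (fun t => (hxm t).2.2) (fun t t' _ => ⟨rfl, fun h => hx h⟩)
  have keyj := sum_card_matchings_le (T := Fin (n + 1)) (β := Unit) c U j n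
    (fun t => U \ {v, x t, y t, z t}) (fun _ => v) y (fun _ => ())
    (fun t => Finset.sdiff_subset) (fun t => hv) (fun t => (hym t).1) (by simp) (by simp)
    (fun t => (hym t).2.1.symm) (fun t => (hym t).2.2) (fun t t' _ => ⟨rfl, fun h => hy h⟩)
  have keyk := sum_card_matchings_le (T := Fin (n + 1)) (β := Unit) c U k n
    (fun t => U \ {v, x t, y t, z t}) (fun _ => v) z (fun _ => ())
    (fun t => Finset.sdiff_subset) (fun t => hv) (fun t => (hzm t).1) (by simp) (by simp)
    (fun t => (hzm t).2.1.symm) (fun t => (hzm t).2.2) (fun t t' _ => ⟨rfl, fun h => hz h⟩)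
  have hsum := Finset.sum_le_sum (fun t (_ : t ∈ (Finset.univ : Finset (Fin (n + 1)))) =>
    ih (U \ {v, x t, y t, z t}) (by
      have h1 := Finset.le_card_sdiff {v, x t, y t, z t} U
      have h2 := Finset.card_le_four (a := v) (b := x t) (c := y t) (d := z t)
      omega))
  rw [Finset.sum_add_distrib, Finset.sum_add_distrib] at hsum
  simp only [Finset.sum_const, Finset.card_univ, Fintype.card_fin, smul_eq_mul] at hsum
  simp only [Fintype.card_unit, one_mul] at keyi keyj keyk
  rw [Nat.factorial_succ]
  omega

open Nat in
theorem factorial_succ_le_card_matchings_three_of_low (c : Sym2 V → C) {i j k : C}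
    (hij : i ≠ j) (hik : i ≠ k) (hjk : j ≠ k) (htot : ∀ e, c e = i ∨ c e = j ∨ c e = k) (n : ℕ)
    (ih : ∀ U : Finset V, 4 * n ≤ U.card + 2 →
      n ! ≤ (matchings c U i n).card + (matchings c U j n).card + (matchings c U k n).card)
    {U : Finset V} (hU : 4 * (n + 1) ≤ U.card + 2) {v : V} (hv : v ∈ U)
    (hvi : (nbrs c U i v).card ≤ n) (hvj : n + 1 ≤ (nbrs c U j v).card)
    (hvk : n + 1 ≤ (nbrs c U k v).card) :
    (n + 1)! ≤ (matchings c U i (n + 1)).card + (matchings c U j (n + 1)).card +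
      (matchings c U k (n + 1)).card := by
  set X : Finset V := {w ∈ U | n + 1 ≤ (nbrs c U i w).card} with hX
  by_cases hcard : n + 1 ≤ (nbrs c U j v ∩ X).card + (nbrs c U k v ∩ X).card
  · obtain ⟨x, y, hx, hy, hxm, hym, hxy⟩ := exists_injective_pair hvj hvk hcard
    simp only [mem_nbrs] at hxm hym
    have hp : ∀ t, ∃ p, (p = x t ∨ p = y t) ∧ p ∈ X := fun t => by
      rcases hxy t with h | h
      · exact ⟨x t, Or.inl rfl, h⟩
      · exact ⟨y t, Or.inr rfl, h⟩
    choose p hpxy hpX using hp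
    simp only [hX, Finset.mem_filter] at hpX
    choose z hz hzm using fun t => exists_injective_of_le_card (hpX t).2
    simp only [mem_nbrs] at hzm
    let U' : Fin (n + 1) × Fin (n + 1) → Finset V :=
      fun t => U \ {v, x t.1, y t.1, z t.1 t.2}
    have keyi := sum_card_matchings_le (β := Fin (n + 1)) c U i n
      U' (fun t => p t.1) (fun t => z t.1 t.2) (fun t => t.1)
      (fun t => Finset.sdiff_subset) (fun t => (hpX t.1).1) (fun t => (hzm t.1 t.2).1)
      (fun t => by rcases hpxy t.1 with h | h <;> simp [U', h]) (by simp [U'])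
      (fun t => (hzm t.1 t.2).2.1.symm) (fun t => (hzm t.1 t.2).2.2)
      (by
        rintro ⟨t, l⟩ ⟨t', l'⟩ h
        obtain rfl : t = t' := h
        exact ⟨rfl, fun h => Prod.ext rfl (hz t h)⟩)
    have keyj := sum_card_matchings_le (β := Fin (n + 1)) c U j n
      U' (fun _ => v) (fun t => x t.1) (fun t => t.2)
      (fun t => Finset.sdiff_subset) (fun t => hv) (fun t => (hxm t.1).1) (by simp [U'])
      (by simp [U']) (fun t => (hxm t.1).2.1.symm) (fun t => (hxm t.1).2.2)
      (fun t t' h => ⟨rfl, fun h' => Prod.ext (hx h') h⟩)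
    have keyk := sum_card_matchings_le (β := Fin (n + 1)) c U k n
      U' (fun _ => v) (fun t => y t.1) (fun t => t.2)
      (fun t => Finset.sdiff_subset) (fun t => hv) (fun t => (hym t.1).1) (by simp [U'])
      (by simp [U']) (fun t => (hym t.1).2.1.symm) (fun t => (hym t.1).2.2)
      (fun t t' h => ⟨rfl, fun h' => Prod.ext (hy h') h⟩)
    have hsum := Finset.sum_le_sum
      (fun t (_ : t ∈ (Finset.univ : Finset (Fin (n + 1) × Fin (n + 1)))) => ih (U' t) (by
        have h1 := Finset.le_card_sdiff {v, x t.1, y t.1, z t.1 t.2} U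
        have h2 := Finset.card_le_four (a := v) (b := x t.1) (c := y t.1) (d := z t.1 t.2)
        simp only [U']
        omega))
    rw [Finset.sum_add_distrib, Finset.sum_add_distrib] at hsum
    simp only [Finset.sum_const, Finset.card_univ, Fintype.card_prod, Fintype.card_fin,
      smul_eq_mul] at hsum keyi keyj keyk
    rw [Nat.factorial_succ]
    refine Nat.le_of_mul_le_mul_left (c := n + 1) ?_ (Nat.succ_pos n)
    linarith
  · have hXv : X ⊆ nbrs c U i v ∪ ((nbrs c U j v ∩ X) ∪ (nbrs c U k v ∩ X)) := by
      intro w hw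
      have hwv : w ≠ v := by
        rintro rfl
        have := (Finset.mem_filter.1 hw).2
        omega
      have hwU := (Finset.mem_filter.1 hw).1
      have := htot s(v, w)
      simp only [Finset.mem_union, Finset.mem_inter, mem_nbrs]
      tauto
    have h1 := Finset.card_le_card hXv
    have h2 := Finset.card_union_le (nbrs c U i v) ((nbrs c U j v ∩ X) ∪ (nbrs c U k v ∩ X))
    have h3 := Finset.card_union_le (nbrs c U j v ∩ X) (nbrs c U k v ∩ X)
    have h4 := Finset.le_card_sdiff X U
    have h5 := factorial_le_card_matchings_two c hjk (n + 1) U (U \ X) Finset.sdiff_subset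
      (by omega) (by
        intro w hw
        simp only [hX, Finset.mem_sdiff, Finset.mem_filter, not_and, not_le] at hw
        have h6 := card_nbrs_three c hij hik hjk htot hw.1
        have h7 := hw.2 hw.1
        omega)
    omega

open Nat in
/-- Every `3`-edge-coloring of a complete graph on at least `4n - 2` vertices has at least `n!`
monochromatic matchings with `n` edges. -/
theorem factorial_le_card_matchings_three (c : Sym2 V → C) {i j k : C}
    (hij : i ≠ j) (hik : i ≠ k) (hjk : j ≠ k) (htot : ∀ e, c e = i ∨ c e = j ∨ c e = k) (n : ℕ) :
    ∀ U : Finset V, 4 * n ≤ U.card + 2 →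
      n ! ≤ (matchings c U i n).card + (matchings c U j n).card + (matchings c U k n).card := by
  induction n with
  | zero => intro U _; simp [card_matchings_zero]
  | succ n ih =>
    intro U hU
    have hdeg := fun v (hv : v ∈ U) => card_nbrs_three c hij hik hjk htot hv
    by_cases hall : ∀ v ∈ U, 2 * (n + 1) ≤ (nbrs c U i v).card + 1 ∨
        2 * (n + 1) ≤ (nbrs c U j v).card + 1 ∨ 2 * (n + 1) ≤ (nbrs c U k v).card + 1
    · have hcover : U ⊆ {v ∈ U | 2 * (n + 1) ≤ (nbrs c U i v).card + 1} ∪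
          ({v ∈ U | 2 * (n + 1) ≤ (nbrs c U j v).card + 1} ∪
          {v ∈ U | 2 * (n + 1) ≤ (nbrs c U k v).card + 1}) := by
        intro v hv
        simpa only [Finset.mem_union, Finset.mem_filter, hv, true_and] using hall v hv
      have hcard := (Finset.card_le_card hcover).trans ((Finset.card_union_le _ _).trans
        (Nat.add_le_add_left (Finset.card_union_le _ _) _))
      have hdone : ∀ l, n + 1 ≤ {v ∈ U | 2 * (n + 1) ≤ (nbrs c U l v).card + 1}.card →
          (n + 1)! ≤ (matchings c U l (n + 1)).card := fun l h =>
        factorial_le_card_matchings_of_degree c l (n + 1) (Finset.filter_subset _ _) h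
          (fun v hv => (Finset.mem_filter.1 hv).2)
      have hi := hdone i
      have hj := hdone j
      have hk := hdone k
      omega
    · push Not at hall
      obtain ⟨v, hv, h1, h2, h3⟩ := hall
      have h4 := hdeg v hv
      by_cases hi : n + 1 ≤ (nbrs c U i v).card
      · by_cases hj : n + 1 ≤ (nbrs c U j v).card
        · by_cases hk : n + 1 ≤ (nbrs c U k v).card
          · exact factorial_succ_le_card_matchings_three_of_star c n ih hU hv hi hj hk
          · have := factorial_succ_le_card_matchings_three_of_low c hik.symm hjk.symm hij
              (fun e => by have := htot e; tauto) n (fun W hW => by have := ih W hW; omega) hU hv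
              (by omega) hi hj
            omega
        · have := factorial_succ_le_card_matchings_three_of_low c hij.symm hjk hik
            (fun e => by have := htot e; tauto) n (fun W hW => by have := ih W hW; omega) hU hv
            (by omega) hi (by omega)
          omega
      · exact factorial_succ_le_card_matchings_three_of_low c hij hik hjk htot n ih hU hv
          (by omega) (by omega) (by omega)

end Counting

section Copies

theorem mem_edgeSet_nK2 {n : ℕ} {e : Sym2 (Fin n × Fin 2)} :
    e ∈ (nK2 n).edgeSet ↔ ∃ a, e = s((a, 0), (a, 1)) := by
  induction e with
  | _ p q =>
    obtain ⟨a, x⟩ := p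
    obtain ⟨b, y⟩ := q
    simp only [mem_edgeSet, nK2, fromRel_adj, Sym2.eq_iff, Prod.mk.injEq, ne_eq]
    constructor
    · rintro ⟨hne, hab⟩
      have hab : a = b := by tauto
      subst hab
      refine ⟨a, ?_⟩
      fin_cases x <;> fin_cases y <;> simp_all
    · rintro ⟨d, ⟨⟨rfl, rfl⟩, rfl, rfl⟩ | ⟨⟨rfl, rfl⟩, rfl, rfl⟩⟩ <;> simp

theorem isMonoCopy_nK2_iff {C : Type} {n m : ℕ} (c : Sym2 (Fin m) → C) (S : Set (Sym2 (Fin m))) :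
    IsMonoCopy (nK2 n) c S ↔ 
      ∃ i, ∃ M ∈ matchings c Finset.univ i n, (M : Set (Sym2 (Fin m))) = S := by
  constructor
  · rintro ⟨⟨f, hf, rfl⟩, i, hi⟩
    have hinj : Injective fun a : Fin n => s(f (a, 0), f (a, 1)) := by
      intro a b h
      simp only [Sym2.eq_iff, hf.eq_iff, Prod.mk.injEq] at h
      tauto
    have hmem : ∀ a : Fin n, s(f (a, 0), f (a, 1)) ∈ Sym2.map f '' (nK2 n).edgeSet := fun a =>
      ⟨s((a, 0), (a, 1)), mem_edgeSet_nK2.2 ⟨a, rfl⟩, by simp⟩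
    refine ⟨i, Finset.univ.image fun a : Fin n => s(f (a, 0), f (a, 1)),
      mem_matchings.2 ⟨?_, ?_⟩, ?_⟩
    · intro e he
      simp only [Finset.mem_image, Finset.mem_univ, true_and] at he
      obtain ⟨a, rfl⟩ := he
      refine ⟨by simp [hf.eq_iff], hi _ (hmem a), by simp, ?_⟩
      intro g hg v hv hvg
      simp only [Finset.mem_image, Finset.mem_univ, true_and] at hg
      obtain ⟨b, rfl⟩ := hg
      have hab : a = b := by
        rcases Sym2.mem_iff.1 hv with rfl | rfl <;> rcases Sym2.mem_iff.1 hvg with h | h <;>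
          exact congrArg Prod.fst (hf h)
      rw [hab]
    · rw [Finset.card_image_of_injective _ hinj, Finset.card_univ, Fintype.card_fin]
    · ext e
      simp only [Finset.coe_image, Finset.coe_univ, Set.image_univ, Set.mem_range]
      constructor
      · rintro ⟨a, rfl⟩
        exact hmem a
      · rintro ⟨e, he, rfl⟩
        obtain ⟨a, rfl⟩ := mem_edgeSet_nK2.1 he
        exact ⟨a, by simp⟩
  · rintro ⟨i, M, hM, rfl⟩
    obtain ⟨hM, hcard⟩ := mem_matchings.1 hM
    obtain ⟨σ⟩ : Nonempty (Fin n ≃ M) := by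
      rw [← Fintype.card_eq, Fintype.card_coe, hcard, Fintype.card_fin]
    have hout : ∀ t, ∃ a b, (σ t : Sym2 (Fin m)) = s(a, b) := fun t => by
      induction (σ t : Sym2 (Fin m)) with
      | _ a b => exact ⟨a, b, rfl⟩
    choose a b hab using hout
    have hne : ∀ t, a t ≠ b t := by
      intro t h
      have := (hM _ (σ t).2).1
      rw [hab t] at this
      exact this (by simpa using h)
    have hσ : ∀ t t' v, v ∈ s(a t, b t) → v ∈ s(a t', b t') → t = t' := by
      intro t t' v h h'
      rw [← hab] at h h'
      exact σ.injective (Subtype.ext ((hM _ (σ t).2).2.2.2 _ (σ t').2 v h h'))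
    refine ⟨⟨fun p => ![a p.1, b p.1] p.2, ?_, ?_⟩, i, fun e he => (hM e he).2.1⟩
    · have hmem : ∀ p : Fin n × Fin 2, ![a p.1, b p.1] p.2 ∈ s(a p.1, b p.1) := by
        rintro ⟨t, x⟩
        fin_cases x <;> simp
      rintro ⟨t, x⟩ ⟨t', x'⟩ h
      obtain rfl : t = t' := hσ t t' _ (hmem (t, x)) (by
        have h' : ![a t, b t] x = ![a t', b t'] x' := h
        change ![a t, b t] x ∈ _
        rw [h']
        exact hmem (t', x'))
      have h1 := hne t
      fin_cases x <;> fin_cases x' <;> first | rfl | exact absurd h h1 | exact absurd h.symm h1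
    · ext e
      constructor
      · intro he
        refine ⟨s((σ.symm ⟨e, he⟩, 0), (σ.symm ⟨e, he⟩, 1)), mem_edgeSet_nK2.2 ⟨_, rfl⟩, ?_⟩
        simp [← hab]
      · rintro ⟨e, he, rfl⟩
        obtain ⟨t, rfl⟩ := mem_edgeSet_nK2.1 he
        simp only [Sym2.map_mk, Matrix.cons_val_zero, Matrix.cons_val_one]
        rw [← hab t]
        exact (σ t).2

theorem monoCopyCount_nK2 {C : Type} [Fintype C] {n m : ℕ} (hn : n ≠ 0) (c : Sym2 (Fin m) → C) :
    monoCopyCount (nK2 n) c = ∑ i, (matchings c Finset.univ i n).card := by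
  classical
  have hset : {S | IsMonoCopy (nK2 n) c S} = (fun M : Finset (Sym2 (Fin m)) => (M : Set _)) ''
      (Finset.univ.biUnion fun i => matchings c Finset.univ i n : Finset _) := by
    ext S
    simp [isMonoCopy_nK2_iff]
    tauto
  rw [monoCopyCount, hset, Set.ncard_image_of_injective _ Finset.coe_injective,
    Set.ncard_coe_finset, Finset.card_biUnion]
  intro i _ j _ hij
  refine Finset.disjoint_left.2 fun M hM hM' => hij ?_
  obtain ⟨hM, hcard⟩ := mem_matchings.1 hM
  obtain ⟨hM', -⟩ := mem_matchings.1 hM'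
  obtain ⟨e, he⟩ := Finset.card_pos.1 (by omega : 0 < M.card)
  exact (hM e he).2.1.symm.trans (hM' e he).2.1

open Nat in
theorem factorial_le_monoCopyCount {n m : ℕ} (hn : n ≠ 0) (hm : 4 * n ≤ m + 2)
    (c : Sym2 (Fin m) → Fin 3) : n ! ≤ monoCopyCount (nK2 n) c := by
  rw [monoCopyCount_nK2 hn, Fin.sum_univ_three]
  exact factorial_le_card_matchings_three c (by decide) (by decide) (by decide)
    (fun e => by generalize c e = x; revert x; decide) n Finset.univ (by simpa using hm)

theorem hasMonoCopy_of_monoCopyCount_pos {α C : Type} {H : SimpleGraph α} {m : ℕ}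
    {c : Sym2 (Fin m) → C} (h : 0 < monoCopyCount H c) : HasMonoCopy H c :=
  Set.nonempty_of_ncard_ne_zero h.ne'

theorem not_isRainbowCopy_P5 {m : ℕ} (c : Sym2 (Fin m) → Fin 3) (S : Set (Sym2 (Fin m))) :
    ¬ IsRainbowCopy P5 c S := by
  rintro ⟨⟨f, hf, rfl⟩, hinj⟩
  have hmem : ∀ a : Fin 4, s(a.castSucc, a.succ) ∈ P5.edgeSet := by
    intro a
    rw [mem_edgeSet, P5, pathGraph_adj]
    left
    simp
  have key : ∀ a b : Fin 4, s(a.castSucc, a.succ) = s(b.castSucc, b.succ) → a = b := by decide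
  have : Injective fun a : Fin 4 => c (Sym2.map f s(a.castSucc, a.succ)) := by
    intro a b h
    exact key a b (Sym2.map.injective hf (hinj ⟨_, hmem a, rfl⟩ ⟨_, hmem b, rfl⟩ h))
  simpa using Fintype.card_le_of_injective _ this

open Classical in
/-- The extremal coloring: edges meeting the first `n - 1` vertices get color `1`, the remaining
edges meeting the next `n - 1` vertices get color `2`, all others get color `0`. -/
noncomputable def extremalColoring (n m : ℕ) (e : Sym2 (Fin m)) : Fin 3 :=
  if ∃ v ∈ e, v.val < n - 1 then 1 else if ∃ v ∈ e, v.val < 2 * n - 2 then 2 else 0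

theorem matchings_extremalColoring_one {n : ℕ} (hn : n ≠ 0) (m : ℕ) :
    matchings (extremalColoring n m) Finset.univ 1 n = ∅ := by
  refine Finset.eq_empty_of_forall_notMem fun M hM => ?_
  obtain ⟨hM, hcard⟩ := mem_matchings.1 hM
  have h1 := hM.card_le_of_cover (W := {v | v.val < n - 1}) (fun e he => by
    have := (hM e he).2.1
    unfold extremalColoring at this
    split_ifs at this with h
    · simpa using h
    all_goals simp at this)
  have h2 := Finset.card_le_card_of_injOn (s := {v : Fin m | v.val < n - 1})
    (t := Finset.range (n - 1)) Fin.val (fun v hv => by simpa using hv) Fin.val_injective.injOn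
  rw [Finset.card_range] at h2
  omega

theorem matchings_extremalColoring_two {n : ℕ} (hn : n ≠ 0) (m : ℕ) :
    matchings (extremalColoring n m) Finset.univ 2 n = ∅ := by
  refine Finset.eq_empty_of_forall_notMem fun M hM => ?_
  obtain ⟨hM, hcard⟩ := mem_matchings.1 hM
  have h1 := hM.card_le_of_cover (W := {v | n - 1 ≤ v.val ∧ v.val < 2 * n - 2}) (fun e he => by
    have := (hM e he).2.1
    unfold extremalColoring at this
    split_ifs at this with h h'
    · simp at this
    · obtain ⟨v, hv, hlt⟩ := h'
      push Not at h
      exact ⟨v, hv, Finset.mem_filter.2 ⟨Finset.mem_univ v, h v hv, hlt⟩⟩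
    · simp at this)
  have h2 := Finset.card_le_card_of_injOn (s := {v : Fin m | n - 1 ≤ v.val ∧ v.val < 2 * n - 2})
    (t := Finset.Ico (n - 1) (2 * n - 2)) Fin.val (fun v hv => by simpa using hv)
    Fin.val_injective.injOn
  rw [Nat.card_Ico] at h2
  omega

theorem matchings_extremalColoring_zero_subset (n m : ℕ) :
    matchings (extremalColoring n m) Finset.univ 0 n ⊆
      matchings (extremalColoring n m) {v | 2 * n - 2 ≤ v.val} 0 n := by
  intro M hM
  obtain ⟨hM, hcard⟩ := mem_matchings.1 hM
  refine mem_matchings.2 ⟨fun e he => ?_, hcard⟩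
  obtain ⟨h1, h2, -, h4⟩ := hM e he
  refine ⟨h1, h2, fun v hv => ?_, h4⟩
  have h' : ¬ ∃ v ∈ e, v.val < 2 * n - 2 := by
    intro h'
    unfold extremalColoring at h2
    by_cases h : ∃ v ∈ e, v.val < n - 1
    · rw [if_pos h] at h2
      exact absurd h2 (by decide)
    · rw [if_neg h, if_pos h'] at h2
      exact absurd h2 (by decide)
  push Not at h'
  simpa using h' v hv

theorem card_filter_le_val (a m : ℕ) : ({v | a ≤ v.val} : Finset (Fin m)).card = m - a := by
  rw [← Finset.card_image_of_injective _ Fin.val_injective, ← Nat.card_Ico]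
  congr 1
  ext x
  simp only [Finset.mem_image, Finset.mem_filter, Finset.mem_univ, true_and, Finset.mem_Ico]
  constructor
  · rintro ⟨v, hv, rfl⟩
    exact ⟨hv, v.2⟩
  · rintro ⟨h1, h2⟩
    exact ⟨⟨x, h2⟩, h1, rfl⟩

theorem monoCopyCount_extremalColoring_le {n : ℕ} (hn : n ≠ 0) (m : ℕ) :
    monoCopyCount (nK2 n) (extremalColoring n m) ≤
      (matchings (extremalColoring n m) {v | 2 * n - 2 ≤ v.val} 0 n).card := by
  rw [monoCopyCount_nK2 hn, Fin.sum_univ_three, matchings_extremalColoring_one hn,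
    matchings_extremalColoring_two hn]
  simpa using Finset.card_le_card (matchings_extremalColoring_zero_subset n m)

theorem not_hasMonoCopy_extremalColoring {n m : ℕ} (hn : n ≠ 0) (hm : m + 2 < 4 * n) :
    ¬ HasMonoCopy (nK2 n) (extremalColoring n m) := by
  rintro ⟨S, hS⟩
  obtain ⟨i, M, hM, rfl⟩ := (isMonoCopy_nK2_iff _ _).1 hS
  fin_cases i
  · obtain ⟨hM, hcard⟩ := mem_matchings.1 (matchings_extremalColoring_zero_subset n m hM)
    have := Finset.card_le_card hM.biUnion_toFinset_subset
    rw [hM.card_biUnion_toFinset, card_filter_le_val] at this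
    omega
  · have := matchings_extremalColoring_one hn m
    simp_all
  · have := matchings_extremalColoring_two hn m
    simp_all

theorem extremalColoring_surjective {n m : ℕ} (hn : 2 ≤ n) (hm : 2 * n - 2 < m) :
    Surjective (extremalColoring n m) := by
  intro i
  fin_cases i
  · refine ⟨s(⟨2 * n - 2, hm⟩, ⟨2 * n - 2, hm⟩), ?_⟩
    simp [extremalColoring, show ¬ (2 * n - 2 < n - 1) by omega]
  · refine ⟨s(⟨0, by omega⟩, ⟨0, by omega⟩), ?_⟩
    simp [extremalColoring, show 0 < n - 1 by omega]
  · refine ⟨s(⟨n - 1, by omega⟩, ⟨n - 1, by omega⟩), ?_⟩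
    simp [extremalColoring, show n - 1 < 2 * n - 2 by omega]

theorem gr_three_P5_nK2 {n : ℕ} (hn : n ≠ 0) : gr 3 P5 (nK2 n) = 4 * n - 2 := by
  refine le_antisymm (Nat.sInf_le fun c => Or.inr (hasMonoCopy_of_monoCopyCount_pos
    ((Nat.factorial_pos n).trans_le (factorial_le_monoCopyCount hn (by omega) c)))) ?_
  refine le_csInf ⟨4 * n - 2, fun c => Or.inr (hasMonoCopy_of_monoCopyCount_pos
    ((Nat.factorial_pos n).trans_le (factorial_le_monoCopyCount hn (by omega) c)))⟩ ?_
  intro m hm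
  by_contra hlt
  rcases hm (extremalColoring n m) with ⟨S, hS⟩ | h
  · exact not_isRainbowCopy_P5 _ S hS
  · exact not_hasMonoCopy_extremalColoring hn (by omega) h

theorem rainbowCopyCount_P5 {m : ℕ} (c : Sym2 (Fin m) → Fin 3) : rainbowCopyCount P5 c = 0 := by
  simp [rainbowCopyCount, not_isRainbowCopy_P5]

open Nat in
theorem factorial_two_mul_div {n : ℕ} (hn : n ≠ 0) :
    (2 * n)! / (2 ^ n * n !) = (2 * n - 1)‼ := by
  have h := Nat.factorial_eq_mul_doubleFactorial (2 * n - 1)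
  rw [show 2 * n - 1 + 1 = 2 * n by omega, Nat.doubleFactorial_two_mul] at h
  rw [h, Nat.mul_div_cancel_left _ (by positivity)]

end Copies

end GR

open GR Nat in
/-- For `n ≥ 2`, `n! ≤ GM₃(P₅ : nK₂) ≤ (2n)!/(2ⁿ n!)`. -/
theorem GM_P5_matching_bounds (n : ℕ) (hn : 2 ≤ n) :
    n ! ≤ GM 3 P5 (nK2 n) ∧ GM 3 P5 (nK2 n) ≤ (2 * n)! / (2 ^ n * n !) := by
  have hn0 : n ≠ 0 := by omega
  rw [factorial_two_mul_div hn0, GM, gr_three_P5_nK2 hn0]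
  have hmem : monoCopyCount (nK2 n) (extremalColoring n (4 * n - 2)) ∈
      {t | ∃ c : Sym2 (Fin (4 * n - 2)) → Fin 3, Surjective c ∧
        t = rainbowCopyCount P5 c + monoCopyCount (nK2 n) c} :=
    ⟨_, extremalColoring_surjective hn (by omega), by rw [rainbowCopyCount_P5, zero_add]⟩
  constructor
  · refine le_csInf ⟨_, hmem⟩ ?_
    rintro t ⟨c, -, rfl⟩
    exact (factorial_le_monoCopyCount hn0 (by omega) c).trans (Nat.le_add_left _ _)
  · refine (Nat.sInf_le hmem).trans ((monoCopyCount_extremalColoring_le hn0 _).trans ?_)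
    apply card_matchings_le_doubleFactorial
    rw [card_filter_le_val]
    omega
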